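/- Let n ≥ 2 be an integer and let s, δ, k be real numbers with s ≥ −1, 0 < δ < 1, s + 2δ < 1/2 and k > 1 + 2(s+1). Then there exists a constant C > 0 such that for every p ∈ (ℕ*)^n: Σ_{q ∈ (ℕ*)^n, |q| ≠ |p|} q_n^{2s+2} · | |q|² − |p|² |^{−2(1−δ)} · ∏_{j=1}^{n−1} ⟨p_j − q_j⟩^{−k} ≤ C ⟨p⟩^{2s+2}. -/

import Mathlib

/-- Japanese bracket `⟨y⟩ = (1 + y²)^{1/2}`. -/
noncomputable def jb (y : ℝ) : ℝ := Real.sqrt (1 + y ^ 2)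

/-- `|p|² = p₁² + ⋯ + p_n²` for a tuple of positive integers. -/
noncomputable def pnorm2 {n : ℕ} (p : Fin n → ℕ+) : ℝ := ∑ j, ((p j : ℝ)) ^ 2

open scoped ENNReal

lemma one_le_jb (y : ℝ) : 1 ≤ jb y := by
  unfold jb
  rw [Real.one_le_sqrt]
  nlinarith [sq_nonneg y]

lemma jb_pos (y : ℝ) : 0 < jb y := lt_of_lt_of_le one_pos (one_le_jb y)

lemma abs_le_jb (y : ℝ) : |y| ≤ jb y := by
  unfold jb
  exact Real.abs_le_sqrt (by linarith)

lemma jb_sq (y : ℝ) : jb y ^ 2 = 1 + y ^ 2 := Real.sq_sqrt (by positivity)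

lemma summable_jb_rpow_neg {k : ℝ} (hk : 1 < k) :
    Summable fun z : ℤ => jb (z : ℝ) ^ (-k) := by
  refine Summable.of_norm_bounded_eventually (Real.summable_abs_int_rpow hk) ?_
  have : ∀ᶠ z : ℤ in Filter.cofinite, z ≠ 0 := by
    simpa using (Set.finite_singleton (0 : ℤ)).compl_mem_cofinite
  filter_upwards [this] with z hz
  rw [Real.norm_of_nonneg (Real.rpow_nonneg (jb_pos _).le _)]
  exact Real.rpow_le_rpow_of_nonpos (by positivity) (abs_le_jb _) (by linarith)

lemma tsum_jb_sub_le (k : ℝ) (N : ℤ) :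
    ∑' m : ℕ+, ENNReal.ofReal (jb ((m : ℝ) - N) ^ (-k)) ≤
      ∑' z : ℤ, ENNReal.ofReal (jb (z : ℝ) ^ (-k)) := by
  have hinj : Function.Injective fun m : ℕ+ => ((m : ℕ) : ℤ) - N := by
    intro x y h
    apply PNat.coe_injective
    simp only at h
    omega
  refine le_trans (le_of_eq ?_)
    (ENNReal.tsum_comp_le_tsum_of_injective hinj fun z : ℤ => ENNReal.ofReal (jb (z : ℝ) ^ (-k)))
  refine tsum_congr fun m => ?_
  push_cast
  rfl

lemma jb_neg (y : ℝ) : jb (-y) = jb y := by simp [jb]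

lemma ENNReal.tsum_pi_fin_prod {ι : Type*} (m : ℕ) (f : Fin m → ι → ℝ≥0∞) :
    ∑' q : Fin m → ι, ∏ i, f i (q i) = ∏ i, ∑' x, f i x := by
  induction m with
  | zero => simp [tsum_fintype]
  | succ m ih =>
    rw [← (Fin.consEquiv fun _ => ι).tsum_eq, ENNReal.tsum_prod', Fin.prod_univ_succ,
      ← ih, ← ENNReal.tsum_mul_right]
    refine tsum_congr fun x => ?_
    rw [← ENNReal.tsum_mul_left]
    refine tsum_congr fun y => ?_
    simp [Fin.prod_univ_succ, Fin.consEquiv]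

/-- A nonzero value of `m² - M` is at least comparable to the square of the distance between `m`
and the integer part of `√M`. -/
lemma one_add_sq_le_four_mul_abs (m : ℕ) (M : ℤ) (h : (m : ℤ) ^ 2 ≠ M) :
    1 + ((m : ℤ) - (Nat.sqrt M.toNat : ℕ)) ^ 2 ≤ 4 * |(m : ℤ) ^ 2 - M| := by
  obtain hM | hM := lt_or_ge M 0
  · have : M.toNat = 0 := by omega
    rw [this, abs_of_nonneg (by nlinarith)]
    simp only [Nat.sqrt_zero, Nat.cast_zero]
    nlinarith
  · lift M to ℕ using hM
    simp only [Int.toNat_natCast]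
    have h1 := Nat.sqrt_le' M
    have h2 := Nat.lt_succ_sqrt' M
    set N := Nat.sqrt M
    zify at h1 h2
    obtain hlt | hlt := lt_or_gt_of_ne h
    · rw [abs_of_neg (by omega)]
      have hmN : (m : ℤ) ≤ N := by
        by_contra hc
        push Not at hc
        nlinarith
      nlinarith [Int.natCast_nonneg m]
    · rw [abs_of_pos (by omega)]
      have hmN : (N : ℤ) ≤ m := by
        by_contra hc
        push Not at hc
        nlinarith [Int.natCast_nonneg m]
      obtain heq | hN := hmN.eq_or_lt
      · nlinarith
      · nlinarith [sq_nonneg ((m : ℤ) - N - 2), Int.natCast_nonneg N]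

lemma rpow_mul_abs_rpow_le {a b P : ℝ} (ha : 0 ≤ a) (hb : 0 ≤ b) (hP : 1 ≤ P) (m : ℕ+) (M : ℤ)
    (h : ((m : ℕ) : ℤ) ^ 2 ≠ M) (hMP : (M : ℝ) ≤ P ^ 2) :
    (m : ℝ) ^ a * |(m : ℝ) ^ 2 - M| ^ (-b) ≤
      2 ^ a * 16 ^ b * P ^ a *
        ((m : ℝ) ^ (-(2 * b - a)) +
          jb ((m : ℝ) - ((Nat.sqrt M.toNat : ℕ) : ℤ)) ^ (-(2 * b))) := by
  have key := one_add_sq_le_four_mul_abs m M h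
  have hNP : ((Nat.sqrt M.toNat : ℕ) : ℝ) ≤ P := by
    obtain hM | hM := lt_or_ge M 0
    · have : M.toNat = 0 := by omega
      rw [this]
      simp
      linarith
    · have h1 : ((Nat.sqrt M.toNat : ℕ) : ℤ) ^ 2 ≤ M := by
        have := Nat.sqrt_le' M.toNat
        zify at this
        rwa [Int.toNat_of_nonneg hM] at this
      have h2 : ((Nat.sqrt M.toNat : ℕ) : ℝ) ^ 2 ≤ M := by exact_mod_cast h1
      exact le_of_sq_le_sq (h2.trans hMP) (by linarith)
  set N := Nat.sqrt M.toNat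
  have keyR : 1 + ((m : ℝ) - N) ^ 2 ≤ 4 * |(m : ℝ) ^ 2 - M| := by exact_mod_cast key
  have hm : (1 : ℝ) ≤ m := by exact_mod_cast (one_le : 1 ≤ m)
  have hm0 : (0 : ℝ) < m := by linarith
  have hX : (0 : ℝ) < |(m : ℝ) ^ 2 - M| := by nlinarith [sq_nonneg ((m : ℝ) - N)]
  have hPa : (1 : ℝ) ≤ P ^ a := Real.one_le_rpow hP ha
  have h2a : (1 : ℝ) ≤ 2 ^ a := Real.one_le_rpow (by norm_num) ha
  have h16 : (1 : ℝ) ≤ 16 ^ b := Real.one_le_rpow (by norm_num) hb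
  have hbound : ∀ y : ℝ, 0 < y → y ^ 2 ≤ 16 * |(m : ℝ) ^ 2 - M| →
      |(m : ℝ) ^ 2 - M| ^ (-b) ≤ 16 ^ b * y ^ (-(2 * b)) := by
    intro y hy hle
    have h1 : |(m : ℝ) ^ 2 - M| ^ (-b) ≤ (y ^ 2 / 16) ^ (-b) :=
      Real.rpow_le_rpow_of_nonpos (by positivity) (by linarith) (by linarith)
    refine h1.trans (le_of_eq ?_)
    rw [Real.div_rpow (by positivity) (by norm_num), ← Real.rpow_natCast, ← Real.rpow_mul hy.le,
      Real.rpow_neg (by norm_num : (0 : ℝ) ≤ 16), div_inv_eq_mul, mul_comm]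
    congr 2
    push_cast
    ring
  obtain hc | hc := le_or_gt (m : ℝ) (2 * N)
  · have h1 := hbound _ (jb_pos ((m : ℝ) - N)) (by rw [jb_sq]; linarith)
    have h2 : (m : ℝ) ^ a ≤ 2 ^ a * P ^ a := by
      rw [← Real.mul_rpow (by norm_num) (by linarith)]
      exact Real.rpow_le_rpow hm0.le (by linarith) ha
    calc (m : ℝ) ^ a * |(m : ℝ) ^ 2 - M| ^ (-b)
        ≤ (2 ^ a * P ^ a) * (16 ^ b * jb ((m : ℝ) - N) ^ (-(2 * b))) :=
          mul_le_mul h2 h1 (by positivity) (by positivity)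
      _ = 2 ^ a * 16 ^ b * P ^ a * jb ((m : ℝ) - N) ^ (-(2 * b)) := by ring
      _ ≤ _ := by
          refine mul_le_mul_of_nonneg_left ?_ (by positivity)
          push_cast
          exact le_add_of_nonneg_left (by positivity)
  · have h1 := hbound m hm0 (by nlinarith [Nat.cast_nonneg (α := ℝ) N])
    have hj := (jb_pos ((m : ℝ) - N)).le
    calc (m : ℝ) ^ a * |(m : ℝ) ^ 2 - M| ^ (-b)
        ≤ (m : ℝ) ^ a * (16 ^ b * (m : ℝ) ^ (-(2 * b))) :=
          mul_le_mul_of_nonneg_left h1 (by positivity)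
      _ = 1 * 16 ^ b * 1 * (m : ℝ) ^ (-(2 * b - a)) := by
          rw [show -(2 * b - a) = a + -(2 * b) by ring, Real.rpow_add hm0]
          ring
      _ ≤ 2 ^ a * 16 ^ b * P ^ a * (m : ℝ) ^ (-(2 * b - a)) := by gcongr
      _ ≤ _ := by
          refine mul_le_mul_of_nonneg_left ?_ (by positivity)
          push_cast
          exact le_add_of_nonneg_right (by positivity)

lemma tsum_fin_succ_le (m : ℕ) (c G S T : ℝ≥0∞) (g : ℕ+ → ℝ≥0∞) (h : (Fin m → ℕ+) → ℕ+ → ℝ≥0∞)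
    (w : Fin m → ℕ+ → ℝ≥0∞) (hg : ∑' x, g x ≤ G) (hh : ∀ y, ∑' x, h y x ≤ S)
    (hw : ∀ i, ∑' x, w i x ≤ T) :
    ∑' q : Fin (m + 1) → ℕ+, c * (g (q (Fin.last m)) +
        h (fun i => q i.castSucc) (q (Fin.last m))) * ∏ i, w i (q i.castSucc) ≤
      c * (G + S) * T ^ m := by
  rw [← (Fin.snocEquiv fun _ => ℕ+).tsum_eq, ENNReal.tsum_prod', ENNReal.tsum_comm]
  simp only [Fin.snocEquiv, Equiv.coe_fn_mk, Fin.snoc_last, Fin.snoc_castSucc]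
  calc ∑' y : Fin m → ℕ+, ∑' x : ℕ+, c * (g x + h y x) * ∏ i, w i (y i)
      ≤ ∑' y : Fin m → ℕ+, c * (G + S) * ∏ i, w i (y i) := by
        refine ENNReal.tsum_le_tsum fun y => ?_
        rw [ENNReal.tsum_mul_right, ENNReal.tsum_mul_left, ENNReal.tsum_add]
        gcongr
        exact hh y
    _ = c * (G + S) * ∏ i, ∑' x, w i x := by
        rw [ENNReal.tsum_mul_left, ENNReal.tsum_pi_fin_prod]
    _ ≤ c * (G + S) * T ^ m := by
        gcongr
        simpa using Finset.prod_le_pow_card Finset.univ (fun i => ∑' x, w i x) T fun i _ => hw i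

/-- Claim 4: for `n ≥ 2`, `s ≥ −1`, `0 < δ < 1`, `s + 2δ < 1/2`, `k > 1 + 2(s+1)`,
`Σ_{q, |q| ≠ |p|} q_n^{2s+2} ||q|²−|p|²|^{−2(1−δ)} ∏_{j<n} ⟨p_j−q_j⟩^{−k} ≤ C ⟨p⟩^{2s+2}`.
(Stated in `ℝ≥0∞` so that the inequality also asserts summability.) -/
theorem stmt8 (n : ℕ) (hn : 2 ≤ n) (s δ k : ℝ) (hs : -1 ≤ s)
    (hδ0 : 0 < δ) (hδ1 : δ < 1) (hsδ : s + 2 * δ < 1 / 2)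
    (hk : 1 + 2 * (s + 1) < k) :
    ∃ C : ℝ, 0 < C ∧ ∀ p : Fin n → ℕ+,
      ∑' q : {q : Fin n → ℕ+ // pnorm2 q ≠ pnorm2 p},
          ENNReal.ofReal
            ((q.1 ⟨n - 1, by omega⟩ : ℝ) ^ (2 * s + 2) *
              |pnorm2 q.1 - pnorm2 p| ^ (-(2 * (1 - δ))) *
              ∏ j ∈ Finset.univ.erase (⟨n - 1, by omega⟩ : Fin n),
                jb ((p j : ℝ) - (q.1 j : ℝ)) ^ (-k))
        ≤ ENNReal.ofReal (C * Real.sqrt (1 + pnorm2 p) ^ (2 * s + 2)) := by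
  obtain ⟨m, rfl⟩ : ∃ m, n = m + 1 := ⟨n - 1, by omega⟩
  set a := 2 * s + 2 with ha_def
  set b := 2 * (1 - δ) with hb_def
  have ha : 0 ≤ a := by linarith
  have hb : 0 ≤ b := by linarith
  have hab : 1 < 2 * b - a := by linarith
  have hlast : (⟨m + 1 - 1, by omega⟩ : Fin (m + 1)) = Fin.last m := rfl
  simp only [hlast]
  set G := ∑' x : ℕ+, ENNReal.ofReal ((x : ℝ) ^ (-(2 * b - a))) with hG
  set S := ∑' z : ℤ, ENNReal.ofReal (jb (z : ℝ) ^ (-(2 * b))) with hS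
  set T := ∑' z : ℤ, ENNReal.ofReal (jb (z : ℝ) ^ (-k)) with hT
  have hGtop : G ≠ ⊤ := by
    have h1 : Summable fun x : ℕ+ => ((x : ℕ) : ℝ) ^ (-(2 * b - a)) :=
      (Real.summable_nat_rpow.2 (by linarith)).comp_injective PNat.coe_injective
    exact h1.tsum_ofReal_ne_top
  have hStop : S ≠ ⊤ := (summable_jb_rpow_neg (by linarith)).tsum_ofReal_ne_top
  have hTtop : T ≠ ⊤ := (summable_jb_rpow_neg (by linarith)).tsum_ofReal_ne_top
  have hE : (G + S) * T ^ m ≠ ⊤ :=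
    ENNReal.mul_ne_top (ENNReal.add_ne_top.2 ⟨hGtop, hStop⟩) (ENNReal.pow_ne_top hTtop)
  refine ⟨2 ^ a * 16 ^ b * ((G + S) * T ^ m).toReal + 1, by positivity, fun p => ?_⟩
  have hp0 : 0 ≤ pnorm2 p := by unfold pnorm2; positivity
  set P := Real.sqrt (1 + pnorm2 p) with hPdef
  have hP : 1 ≤ P := by rw [hPdef, Real.one_le_sqrt]; linarith
  have hP2 : P ^ 2 = 1 + pnorm2 p := Real.sq_sqrt (by linarith)
  let M : (Fin m → ℕ+) → ℤ := fun y => ∑ j, ((p j : ℕ) : ℤ) ^ 2 - ∑ i, ((y i : ℕ) : ℤ) ^ 2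
  have hM : ∀ y, (M y : ℝ) = pnorm2 p - ∑ i, ((y i : ℕ) : ℝ) ^ 2 := by
    intro y
    simp [M, pnorm2]
  let F : (Fin (m + 1) → ℕ+) → ℝ≥0∞ := fun q =>
    ENNReal.ofReal (2 ^ a * 16 ^ b * P ^ a) *
      (ENNReal.ofReal ((q (Fin.last m) : ℝ) ^ (-(2 * b - a))) +
        ENNReal.ofReal (jb ((q (Fin.last m) : ℝ) -
          ((Nat.sqrt (M fun i => q i.castSucc).toNat : ℕ) : ℤ)) ^ (-(2 * b)))) *
      ∏ i : Fin m, ENNReal.ofReal (jb ((q i.castSucc : ℝ) - ((p i.castSucc : ℕ) : ℤ)) ^ (-k))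
  have hterm : ∀ q : {q : Fin (m + 1) → ℕ+ // pnorm2 q ≠ pnorm2 p},
      ENNReal.ofReal
            ((q.1 (Fin.last m) : ℝ) ^ a * |pnorm2 q.1 - pnorm2 p| ^ (-b) *
              ∏ j ∈ Finset.univ.erase (Fin.last m),
                jb ((p j : ℝ) - (q.1 j : ℝ)) ^ (-k)) ≤ F q.1 := by
    rintro ⟨q, hq⟩
    have hdiff : pnorm2 q - pnorm2 p =
        ((q (Fin.last m) : ℕ) : ℝ) ^ 2 - M fun i => q i.castSucc := by
      rw [hM]
      simp only [pnorm2, Fin.sum_univ_castSucc]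
      ring
    have hne : ((q (Fin.last m) : ℕ) : ℤ) ^ 2 ≠ M fun i => q i.castSucc := by
      intro h
      apply hq
      rw [← sub_eq_zero, hdiff, sub_eq_zero]
      exact_mod_cast h
    have hMP : ((M fun i => q i.castSucc : ℤ) : ℝ) ≤ P ^ 2 := by
      rw [hM, hP2]
      have : 0 ≤ ∑ i : Fin m, ((q i.castSucc : ℕ) : ℝ) ^ 2 := by positivity
      linarith
    have hprod : ∏ j ∈ Finset.univ.erase (Fin.last m), jb ((p j : ℝ) - (q j : ℝ)) ^ (-k) =
        ∏ i : Fin m, jb ((q i.castSucc : ℝ) - ((p i.castSucc : ℕ) : ℤ)) ^ (-k) := by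
      have h1 : (Finset.univ.erase (Fin.last m)) =
          (Finset.univ : Finset (Fin m)).map Fin.castSuccEmb := by
        ext j
        induction j using Fin.lastCases <;> simp [Fin.castSucc_ne_last]
      rw [h1, Finset.prod_map]
      refine Finset.prod_congr rfl fun i _ => ?_
      rw [← jb_neg]
      simp
    have hj : ∀ y r : ℝ, 0 ≤ jb y ^ r := fun y r => Real.rpow_nonneg (jb_pos y).le r
    simp only [F]
    rw [← ENNReal.ofReal_add (by positivity) (hj _ _), ← ENNReal.ofReal_mul (by positivity),
      ← ENNReal.ofReal_prod_of_nonneg fun i _ => hj _ _, ← ENNReal.ofReal_mul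
        (mul_nonneg (by positivity) (add_nonneg (by positivity) (hj _ _)))]
    apply ENNReal.ofReal_le_ofReal
    rw [hprod, hdiff]
    exact mul_le_mul_of_nonneg_right (rpow_mul_abs_rpow_le ha hb hP _ _ hne hMP)
      (Finset.prod_nonneg fun i _ => hj _ _)
  calc _ ≤ ∑' q : {q : Fin (m + 1) → ℕ+ // pnorm2 q ≠ pnorm2 p}, F q.1 :=
        ENNReal.tsum_le_tsum hterm
    _ ≤ ∑' q, F q := ENNReal.tsum_comp_le_tsum_of_injective Subtype.val_injective F
    _ ≤ ENNReal.ofReal (2 ^ a * 16 ^ b * P ^ a) * (G + S) * T ^ m :=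
        tsum_fin_succ_le m _ G S T _
          (fun y x => ENNReal.ofReal (jb ((x : ℝ) -
            ((Nat.sqrt (M y).toNat : ℕ) : ℤ)) ^ (-(2 * b))))
          (fun i x => ENNReal.ofReal (jb ((x : ℝ) - ((p i.castSucc : ℕ) : ℤ)) ^ (-k)))
          le_rfl (fun y => tsum_jb_sub_le _ _) fun i => tsum_jb_sub_le _ _
    _ = ENNReal.ofReal (2 ^ a * 16 ^ b * P ^ a * ((G + S) * T ^ m).toReal) := by
        rw [ENNReal.ofReal_mul (p := 2 ^ a * 16 ^ b * P ^ a) (by positivity),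
          ENNReal.ofReal_toReal hE, mul_assoc]
    _ ≤ _ := by
        apply ENNReal.ofReal_le_ofReal
        have : 0 ≤ P ^ a := by positivity
        linarith
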